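/- arXiv:2106.02879 — 7 statements merged into one kernel-verified Lean document; each statement's English description precedes it below -/
import Mathlib

section
/- Let X and a be nonnegative measurable functions on [0,∞), let c₁ and c₂ be nonnegative functions on [0,∞) that are integrable on every finite interval, and let M be an increasing function on [0,∞) with M(0) ≥ 1. Assume that for every t ≥ 0 the function s ↦ c₁(s)X(s) + c₂(s)X(s)·log₊ X(s) is integrable on [0,t] and that X(t) + a(t) ≤ M(t) + ∫₀ᵗ c₁(s)X(s) ds + ∫₀ᵗ c₂(s)X(s)·log₊ X(s) ds. Then, setting C₂(t) := ∫₀ᵗ c₂(s) ds, for every t ≥ 0 one has X(t) + a(t) ≤ M(t)^{exp(C₂(t))} · exp( exp(C₂(t)) · ∫₀ᵗ c₁(s)·exp(−C₂(s)) ds ). -/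
open MeasureTheory Real Set

/-- For `r ≥ 0`, `log₊ r := log (max r 1)`. -/
noncomputable def logPlus (r : ℝ) : ℝ := Real.log (max r 1)

namespace AbsolutelyContinuousOnInterval

/-- Postcomposing with a Lipschitz function preserves absolute continuity. -/
theorem lipschitzOnWith_comp {f g : ℝ → ℝ} {a b : ℝ} {K : NNReal}
    (hf : AbsolutelyContinuousOnInterval f a b) (hg : LipschitzOnWith K g (f '' uIcc a b)) :
    AbsolutelyContinuousOnInterval (fun x => g (f x)) a b := by
  rw [absolutelyContinuousOnInterval_iff] at hf ⊢
  intro ε hε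
  obtain ⟨δ, hδ, h⟩ := hf (ε / (K + 1)) (by positivity)
  refine ⟨δ, hδ, fun E hE hlen => ?_⟩
  calc ∑ i ∈ Finset.range E.1, dist (g (f (E.2 i).1)) (g (f (E.2 i).2))
      ≤ ∑ i ∈ Finset.range E.1, K * dist (f (E.2 i).1) (f (E.2 i).2) :=
        Finset.sum_le_sum fun i hi =>
          hg.dist_le_mul _ (mem_image_of_mem f (hE.1 i hi).1) _
            (mem_image_of_mem f (hE.1 i hi).2)
    _ = K * ∑ i ∈ Finset.range E.1, dist (f (E.2 i).1) (f (E.2 i).2) := by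
        rw [Finset.mul_sum]
    _ ≤ K * (ε / (K + 1)) := by
        have := (h E hE hlen).le
        gcongr
    _ < ε := by
        rw [← mul_div_assoc, div_lt_iff₀ (by positivity)]
        linarith

/-- Postcomposing with a `C¹` function preserves absolute continuity. -/
theorem contDiffOn_comp {f g : ℝ → ℝ} {a b : ℝ}
    (hf : AbsolutelyContinuousOnInterval f a b) (hg : ContDiffOn ℝ 1 g (f '' uIcc a b)) :
    AbsolutelyContinuousOnInterval (fun x => g (f x)) a b := by
  have hconv : Convex ℝ (f '' uIcc a b) :=
    ((convex_uIcc a b).isPreconnected.image f hf.continuousOn).convex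
  obtain ⟨K, hK⟩ := hg.exists_lipschitzOnWith (by decide) hconv
    (isCompact_uIcc.image_of_continuousOn hf.continuousOn)
  exact hf.lipschitzOnWith_comp hK

/-- An absolutely continuous function whose derivative is a.e. nonpositive does not increase
from the left to the right endpoint. -/
theorem le_of_ae_hasDerivAt_nonpos {f f' : ℝ → ℝ} {a b : ℝ} (hab : a ≤ b)
    (hf : AbsolutelyContinuousOnInterval f a b)
    (hf' : ∀ᵐ x, x ∈ uIcc a b → HasDerivAt f (f' x) x ∧ f' x ≤ 0) : f b ≤ f a := by
  have hint : ∫ x in a..b, deriv f x ≤ ∫ _ in a..b, (0 : ℝ) := by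
    refine intervalIntegral.integral_mono_ae_restrict hab hf.intervalIntegrable_deriv (by simp) ?_
    rw [Filter.EventuallyLE, ae_restrict_iff' measurableSet_Icc]
    filter_upwards [hf'] with x hx hxmem
    obtain ⟨hd, hle⟩ := hx (by rwa [uIcc_of_le hab])
    rwa [hd.deriv]
  rw [hf.integral_deriv_eq_sub, intervalIntegral.integral_zero] at hint
  linarith

end AbsolutelyContinuousOnInterval

theorem logPlus_nonneg (r : ℝ) : 0 ≤ logPlus r := Real.log_nonneg (le_max_right r 1)

theorem logPlus_le_log {r y : ℝ} (hry : r ≤ y) (hy : 1 ≤ y) : logPlus r ≤ Real.log y :=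
  Real.log_le_log (lt_of_lt_of_le one_pos (le_max_right r 1)) (max_le hry hy)

/-- A bound on `log Y` for `Y = m + ∫ f` when `f ≤ c₁ Y + c₂ Y log Y` pointwise. -/
theorem log_add_integral_le {f c₁ c₂ : ℝ → ℝ} {m T : ℝ} (hT : 0 ≤ T)
    (hc₁int : IntervalIntegrable c₁ volume 0 T) (hc₂int : IntervalIntegrable c₂ volume 0 T)
    (hfint : IntervalIntegrable f volume 0 T)
    (hpos : ∀ t ∈ Icc 0 T, 0 < m + ∫ s in (0:ℝ)..t, f s)
    (hf : ∀ t ∈ Icc 0 T, f t ≤ c₁ t * (m + ∫ s in (0:ℝ)..t, f s)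
      + c₂ t * (m + ∫ s in (0:ℝ)..t, f s) * Real.log (m + ∫ s in (0:ℝ)..t, f s)) :
    Real.log (m + ∫ s in (0:ℝ)..T, f s) ≤ Real.exp (∫ s in (0:ℝ)..T, c₂ s) *
      (Real.log m + ∫ s in (0:ℝ)..T, c₁ s * Real.exp (-(∫ r in (0:ℝ)..s, c₂ r))) := by
  have h0 : (0:ℝ) ∈ uIcc 0 T := left_mem_uIcc
  set Y : ℝ → ℝ := fun t => m + ∫ s in (0:ℝ)..t, f s with hYdef
  set C : ℝ → ℝ := fun t => ∫ s in (0:ℝ)..t, c₂ s with hCdef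
  set D : ℝ → ℝ := fun t => ∫ s in (0:ℝ)..t, c₁ s * Real.exp (-C s) with hDdef
  have hCac : AbsolutelyContinuousOnInterval C 0 T :=
    hc₂int.absolutelyContinuousOnInterval_intervalIntegral h0
  have hEac : AbsolutelyContinuousOnInterval (fun t => Real.exp (-C t)) 0 T :=
    hCac.contDiffOn_comp (g := fun x => Real.exp (-x)) (by fun_prop)
  have hYac : AbsolutelyContinuousOnInterval Y 0 T :=
    (contDiffOn_const (c := m)).absolutelyContinuousOnInterval.fun_add
      (hfint.absolutelyContinuousOnInterval_intervalIntegral h0)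
  have hLac : AbsolutelyContinuousOnInterval (fun t => Real.log (Y t)) 0 T := by
    refine hYac.contDiffOn_comp (g := Real.log) (Real.contDiffOn_log.mono ?_)
    rintro _ ⟨t, ht, rfl⟩
    rw [uIcc_of_le hT] at ht
    exact (hpos t ht).ne'
  have hDint : IntervalIntegrable (fun s => c₁ s * Real.exp (-C s)) volume 0 T :=
    hc₁int.mul_continuousOn hEac.continuousOn
  have hDac : AbsolutelyContinuousOnInterval D 0 T :=
    hDint.absolutelyContinuousOnInterval_intervalIntegral h0
  have key := ((hEac.fun_mul hLac).fun_sub hDac).le_of_ae_hasDerivAt_nonpos hT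
    (f' := fun t => (Real.exp (-C t) * (-c₂ t) * Real.log (Y t)
      + Real.exp (-C t) * (f t / Y t)) - c₁ t * Real.exp (-C t)) <| by
    filter_upwards [hc₂int.ae_hasDerivAt_integral, hfint.ae_hasDerivAt_integral,
      hDint.ae_hasDerivAt_integral] with t hCt hft hDt ht
    have htI : t ∈ Icc 0 T := by rwa [uIcc_of_le hT] at ht
    have hYt : 0 < Y t := hpos t htI
    refine ⟨(((hCt ht 0 h0).fun_neg.exp).fun_mul
      (((hft ht 0 h0).const_add m).log hYt.ne')).fun_sub (hDt ht 0 h0), ?_⟩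
    have hdiv : f t / Y t ≤ c₁ t + c₂ t * Real.log (Y t) := by
      rw [div_le_iff₀ hYt]
      linarith [hf t htI]
    have := mul_le_mul_of_nonneg_left hdiv (Real.exp_pos (-C t)).le
    linarith
  have hY0 : Y 0 = m := by simp [hYdef]
  have hC0 : C 0 = 0 := by simp [hCdef]
  have hD0 : D 0 = 0 := by simp [hDdef]
  simp only [hY0, hC0, hD0, neg_zero, Real.exp_zero, one_mul, sub_zero] at key
  have hE : Real.exp (C T) * Real.exp (-C T) = 1 := by rw [← Real.exp_add]; simp
  calc Real.log (Y T) = Real.exp (C T) * (Real.exp (-C T) * Real.log (Y T)) := by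
        rw [← mul_assoc, hE, one_mul]
    _ ≤ Real.exp (C T) * (Real.log m + D T) := by
        gcongr
        linarith

/-- Gronwall-type inequality with logarithmic nonlinearity (Lemma 3.1). -/
theorem log_gronwall_integral
    (X a c₁ c₂ M : ℝ → ℝ)
    (hX : ∀ t, 0 ≤ t → 0 ≤ X t) (ha : ∀ t, 0 ≤ t → 0 ≤ a t)
    (hXmeas : Measurable X) (hameas : Measurable a)
    (hc₁ : ∀ t, 0 ≤ t → 0 ≤ c₁ t) (hc₂ : ∀ t, 0 ≤ t → 0 ≤ c₂ t)
    (hc₁int : ∀ t, 0 ≤ t → IntervalIntegrable c₁ volume 0 t)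
    (hc₂int : ∀ t, 0 ≤ t → IntervalIntegrable c₂ volume 0 t)
    (hM : MonotoneOn M (Set.Ici 0)) (hM0 : 1 ≤ M 0)
    (hint : ∀ t, 0 ≤ t →
      IntervalIntegrable (fun s => c₁ s * X s + c₂ s * X s * logPlus (X s)) volume 0 t)
    (hineq : ∀ t, 0 ≤ t →
      X t + a t ≤ M t + (∫ s in (0:ℝ)..t, c₁ s * X s)
        + ∫ s in (0:ℝ)..t, c₂ s * X s * logPlus (X s)) :
    ∀ t, 0 ≤ t →
      X t + a t ≤ (M t) ^ (Real.exp (∫ s in (0:ℝ)..t, c₂ s))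
        * Real.exp ((Real.exp (∫ s in (0:ℝ)..t, c₂ s))
            * ∫ s in (0:ℝ)..t, c₁ s * Real.exp (-(∫ r in (0:ℝ)..s, c₂ r))) := by
  intro T hT
  set f₁ : ℝ → ℝ := fun s => c₁ s * X s with hf₁
  set f₂ : ℝ → ℝ := fun s => c₂ s * X s * logPlus (X s) with hf₂
  have hf₁nn : ∀ t, 0 ≤ t → 0 ≤ f₁ t := fun t ht => mul_nonneg (hc₁ t ht) (hX t ht)
  have hf₂nn : ∀ t, 0 ≤ t → 0 ≤ f₂ t := fun t ht =>
    mul_nonneg (mul_nonneg (hc₂ t ht) (hX t ht)) (logPlus_nonneg _)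
  have hf₁int : ∀ t, 0 ≤ t → IntervalIntegrable f₁ volume 0 t := by
    intro t ht
    refine (hint t ht).mono_fun
      ((hc₁int t ht).aestronglyMeasurable_restrict_uIoc.mul hXmeas.aestronglyMeasurable) ?_
    rw [Filter.EventuallyLE, ae_restrict_iff' measurableSet_uIoc]
    refine Filter.Eventually.of_forall fun s hs => ?_
    rw [uIoc_of_le ht] at hs
    have h₁ := hf₁nn s hs.1.le
    have h₂ := hf₂nn s hs.1.le
    rw [Real.norm_of_nonneg h₁, Real.norm_of_nonneg (add_nonneg h₁ h₂)]
    linarith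
  have hf₂int : ∀ t, 0 ≤ t → IntervalIntegrable f₂ volume 0 t := fun t ht => by
    simpa [hf₁, hf₂] using (hint t ht).sub (hf₁int t ht)
  have hsum : ∀ t, 0 ≤ t → (∫ s in (0:ℝ)..t, (f₁ s + f₂ s))
      = (∫ s in (0:ℝ)..t, f₁ s) + ∫ s in (0:ℝ)..t, f₂ s := fun t ht =>
    intervalIntegral.integral_add (hf₁int t ht) (hf₂int t ht)
  have hMT : 1 ≤ M T := hM0.trans (hM self_mem_Ici hT hT)
  have hY1 : ∀ t ∈ Icc 0 T, 1 ≤ M T + ∫ s in (0:ℝ)..t, (f₁ s + f₂ s) := fun t ht => by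
    have := intervalIntegral.integral_nonneg (μ := volume) ht.1
      fun s hs => add_nonneg (hf₁nn s hs.1) (hf₂nn s hs.1)
    linarith
  have hXY : ∀ t ∈ Icc 0 T, X t + a t ≤ M T + ∫ s in (0:ℝ)..t, (f₁ s + f₂ s) := fun t ht => by
    rw [hsum t ht.1]
    linarith [hineq t ht.1, hM ht.1 hT ht.2]
  have hlog := log_add_integral_le (f := fun s => f₁ s + f₂ s) hT (hc₁int T hT) (hc₂int T hT)
    (hint T hT) (fun t ht => one_pos.trans_le (hY1 t ht)) fun t ht => by
      have hXt := hX t ht.1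
      have hle : X t ≤ M T + ∫ s in (0:ℝ)..t, (f₁ s + f₂ s) := by
        linarith [hXY t ht, ha t ht.1]
      have hlogle := logPlus_le_log hle (hY1 t ht)
      have h₁ := hc₁ t ht.1
      have h₂ := hc₂ t ht.1
      have hYnn := hXt.trans hle
      exact add_le_add (mul_le_mul_of_nonneg_left hle h₁)
        (mul_le_mul (mul_le_mul_of_nonneg_left hle h₂) hlogle (logPlus_nonneg _)
          (mul_nonneg h₂ hYnn))
  have hTmem : T ∈ Icc 0 T := right_mem_Icc.2 hT
  refine (hXY T hTmem).trans ?_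
  rw [← Real.exp_log (one_pos.trans_le (hY1 T hTmem)),
    Real.rpow_def_of_pos (one_pos.trans_le hMT), ← Real.exp_add, Real.exp_le_exp]
  linarith
end

section
/- Let T > 0, let Y : [0,T] → [1,∞) be differentiable, let c₁, c₂ : [0,T] → [0,∞) be integrable, let M ≥ 1, and suppose Y(0) ≤ M and Y′(t) ≤ c₁(t)·Y(t) + c₂(t)·Y(t)·log Y(t) for all t ∈ [0,T]. Then, setting C₂(t) := ∫₀ᵗ c₂(s) ds, for every t ∈ [0,T] one has log Y(t) ≤ exp(C₂(t)) · ( log M + ∫₀ᵗ c₁(s)·exp(−C₂(s)) ds ); equivalently, Y(t) ≤ M^{exp(C₂(t))} · exp( exp(C₂(t)) · ∫₀ᵗ c₁(s)·exp(−C₂(s)) ds ). -/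
open MeasureTheory Real Set

/-- Postcomposition with a Lipschitz function preserves absolute continuity. -/
theorem LipschitzOnWith.comp_absolutelyContinuousOnInterval {X Z : Type*} [PseudoMetricSpace X]
    [PseudoMetricSpace Z] {g : X → Z} {f : ℝ → X} {K : NNReal} {s : Set X} {a b : ℝ}
    (hg : LipschitzOnWith K g s) (hf : AbsolutelyContinuousOnInterval f a b)
    (hfs : MapsTo f (uIcc a b) s) : AbsolutelyContinuousOnInterval (g ∘ f) a b := by
  rw [absolutelyContinuousOnInterval_iff] at hf ⊢
  intro ε hε
  obtain ⟨δ, hδ, h⟩ := hf (ε / (K + 1)) (by positivity)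
  refine ⟨δ, hδ, fun E hE hlen ↦ ?_⟩
  have hsum := h E hE hlen
  rw [lt_div_iff₀ (by positivity)] at hsum
  refine lt_of_le_of_lt ?_ hsum
  rw [Finset.sum_mul]
  refine Finset.sum_le_sum fun i hi ↦ ?_
  have hmem := hE.1 i hi
  calc dist (g (f (E.2 i).1)) (g (f (E.2 i).2))
      ≤ K * dist (f (E.2 i).1) (f (E.2 i).2) :=
        hg.dist_le_mul _ (hfs hmem.1) _ (hfs hmem.2)
    _ ≤ dist (f (E.2 i).1) (f (E.2 i).2) * (K + 1) := by
        nlinarith [dist_nonneg (x := f (E.2 i).1) (y := f (E.2 i).2)]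

/-- Postcomposition of a real function with a `C¹` function preserves absolute continuity. -/
theorem ContDiff.comp_absolutelyContinuousOnInterval {g f : ℝ → ℝ} {a b : ℝ}
    (hg : ContDiff ℝ 1 g) (hf : AbsolutelyContinuousOnInterval f a b) :
    AbsolutelyContinuousOnInterval (g ∘ f) a b := by
  obtain ⟨C, hC⟩ := hf.exists_bound
  obtain ⟨K, hK⟩ := hg.contDiffOn.exists_lipschitzOnWith (by decide) (convex_Icc (-C) C)
    isCompact_Icc
  exact hK.comp_absolutelyContinuousOnInterval hf fun x hx ↦ abs_le.1 (hC x hx)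

/-- Integral Gronwall inequality with integrable coefficients. -/
theorem le_exp_integral_mul_of_le_add_integral {u α β : ℝ → ℝ} {a b A : ℝ} (hab : a ≤ b)
    (hu : ContinuousOn u (Icc a b)) (hα : IntervalIntegrable α volume a b)
    (hβ : IntervalIntegrable β volume a b) (hβ0 : ∀ t ∈ Icc a b, 0 ≤ β t)
    (h : ∀ t ∈ Icc a b, u t ≤ A + ∫ s in a..t, (α s + β s * u s)) :
    u b ≤ exp (∫ s in a..b, β s)
      * (A + ∫ s in a..b, α s * exp (-(∫ r in a..s, β r))) := by
  have hφ : IntervalIntegrable (fun s ↦ α s + β s * u s) volume a b :=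
    hα.add (hβ.mul_continuousOn (by rwa [uIcc_of_le hab]))
  set B : ℝ → ℝ := fun t ↦ ∫ s in a..t, β s with hB
  set V : ℝ → ℝ := fun t ↦ A + ∫ s in a..t, (α s + β s * u s) with hV
  have hBac : AbsolutelyContinuousOnInterval B a b :=
    hβ.absolutelyContinuousOnInterval_intervalIntegral left_mem_uIcc
  have hVac : AbsolutelyContinuousOnInterval V a b :=
    (contDiff_const (c := A)).contDiffOn.absolutelyContinuousOnInterval.fun_add
      (hφ.absolutelyContinuousOnInterval_intervalIntegral left_mem_uIcc)
  have hPac : AbsolutelyContinuousOnInterval (fun t ↦ exp (-B t)) a b :=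
    contDiff_exp.comp_absolutelyContinuousOnInterval hBac.neg
  have hPV := hPac.fun_mul hVac
  have hmono : ∫ s in a..b, deriv (fun t ↦ exp (-B t) * V t) s
      ≤ ∫ s in a..b, α s * exp (-B s) := by
    refine intervalIntegral.integral_mono_ae_restrict hab hPV.intervalIntegrable_deriv
      (hα.mul_continuousOn hPac.continuousOn) ?_
    rw [Filter.EventuallyLE, ae_restrict_iff' measurableSet_Icc]
    filter_upwards [hβ.ae_hasDerivAt_integral, hφ.ae_hasDerivAt_integral] with s hBs hVs hs
    have hs' : s ∈ uIcc a b := by rwa [uIcc_of_le hab]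
    have hd := (hBs hs' a left_mem_uIcc).neg.exp.mul ((hVs hs' a left_mem_uIcc).const_add A)
    rw [show deriv (fun t ↦ exp (-B t) * V t) s = _ from hd.deriv]
    have hle := mul_le_mul_of_nonneg_left (h s hs) (mul_nonneg (hβ0 s hs) (exp_pos (-B s)).le)
    simp only [hB, Pi.neg_apply] at hle ⊢
    linarith
  rw [hPV.integral_deriv_eq_sub] at hmono
  have hVb : exp (-B b) * V b ≤ A + ∫ s in a..b, α s * exp (-B s) := by
    have hBa : B a = 0 := intervalIntegral.integral_same
    have hVa : V a = A := by simp [hV]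
    rw [hBa, hVa] at hmono
    simp only [neg_zero, exp_zero, one_mul] at hmono
    linarith
  calc u b ≤ V b := h b ⟨hab, le_rfl⟩
    _ = exp (B b) * (exp (-B b) * V b) := by
        rw [← mul_assoc, ← exp_add, add_neg_cancel, exp_zero, one_mul]
    _ ≤ _ := by gcongr

/-- Differential form of the logarithmic Gronwall inequality (proof of Lemma 3.1). -/
theorem log_gronwall_differential
    (T : ℝ) (hT : 0 < T) (Y Y' c₁ c₂ : ℝ → ℝ) (M : ℝ)
    (hY1 : ∀ t ∈ Set.Icc 0 T, 1 ≤ Y t)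
    (hYd : ∀ t ∈ Set.Icc 0 T, HasDerivAt Y (Y' t) t)
    (hc₁ : ∀ t ∈ Set.Icc 0 T, 0 ≤ c₁ t)
    (hc₂ : ∀ t ∈ Set.Icc 0 T, 0 ≤ c₂ t)
    (hc₁int : IntervalIntegrable c₁ volume 0 T)
    (hc₂int : IntervalIntegrable c₂ volume 0 T)
    (hM : 1 ≤ M) (hY0 : Y 0 ≤ M)
    (hode : ∀ t ∈ Set.Icc 0 T, Y' t ≤ c₁ t * Y t + c₂ t * Y t * Real.log (Y t)) :
    ∀ t ∈ Set.Icc 0 T,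
      Real.log (Y t) ≤ Real.exp (∫ s in (0:ℝ)..t, c₂ s)
          * (Real.log M + ∫ s in (0:ℝ)..t, c₁ s * Real.exp (-(∫ r in (0:ℝ)..s, c₂ r)))
      ∧ Y t ≤ M ^ (Real.exp (∫ s in (0:ℝ)..t, c₂ s))
          * Real.exp ((Real.exp (∫ s in (0:ℝ)..t, c₂ s))
              * ∫ s in (0:ℝ)..t, c₁ s * Real.exp (-(∫ r in (0:ℝ)..s, c₂ r))) := by
  intro t ht
  have hsub : Icc 0 t ⊆ Icc 0 T := Icc_subset_Icc_right ht.2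
  have husub : uIcc 0 t ⊆ uIcc 0 T := by rwa [uIcc_of_le ht.1, uIcc_of_le hT.le]
  have hYpos : ∀ s ∈ Icc 0 T, 0 < Y s := fun s hs ↦ one_pos.trans_le (hY1 s hs)
  have hlog : ∀ s ∈ Icc 0 T, HasDerivAt (fun x ↦ log (Y x)) (Y' s / Y s) s :=
    fun s hs ↦ (hYd s hs).log (hYpos s hs).ne'
  have hcont : ContinuousOn (fun x ↦ log (Y x)) (Icc 0 T) :=
    fun s hs ↦ (hlog s hs).continuousAt.continuousWithinAt
  have hφ : IntervalIntegrable (fun s ↦ c₁ s + c₂ s * log (Y s)) volume 0 T :=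
    hc₁int.add (hc₂int.mul_continuousOn (by rwa [uIcc_of_le hT.le]))
  have hint : ∀ s ∈ Icc 0 T, log (Y s) ≤ log M + ∫ r in (0:ℝ)..s, (c₁ r + c₂ r * log (Y r)) := by
    intro s hs
    have hss : Icc 0 s ⊆ Icc 0 T := Icc_subset_Icc_right hs.2
    have hle := intervalIntegral.sub_le_integral_of_hasDeriv_right_of_le hs.1 (hcont.mono hss)
      (fun x hx ↦ (hlog x (hss (Ioo_subset_Icc_self hx))).hasDerivWithinAt)
      (((intervalIntegrable_iff_integrableOn_Icc_of_le hT.le).1 hφ).mono_set hss)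
      (fun x hx ↦ by
        have hx' := hss (Ioo_subset_Icc_self hx)
        rw [div_le_iff₀ (hYpos x hx')]
        linarith [hode x hx'])
    have h0 := log_le_log (hYpos 0 ⟨le_rfl, hT.le⟩) hY0
    linarith
  have hmain := le_exp_integral_mul_of_le_add_integral ht.1 (hcont.mono hsub)
    (hc₁int.mono_set husub) (hc₂int.mono_set husub) (fun s hs ↦ hc₂ s (hsub hs))
    (fun s hs ↦ hint s (hsub hs))
  refine ⟨hmain, ?_⟩
  rw [rpow_def_of_pos (one_pos.trans_le hM), ← exp_add]
  refine (log_le_iff_le_exp (hYpos t ht)).1 (hmain.trans_eq ?_)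
  ring
end

section
/- Let Y be a nonnegative, measurable, locally bounded function on [0,∞). Let c₁ and c₂ be nonnegative increasing functions on [0,∞), let ε ∈ [0,1), and let c₃ : [0,∞) × (ε,1) → [0,∞) be increasing in its first variable. Suppose that for every θ ∈ (ε,1) and every t ≥ 0 one has Y(t) ≤ c₁(t)·∫₀ᵗ Y(s) ds + c₂(t)·∫₀ᵗ Y(s)·log₊(1/Y(s)) ds + c₃(t,θ)·∫₀ᵗ Y(s)^θ ds, and that for every t > 0, limsup_{θ→1⁻} (1−θ)·c₃(t,θ) < ∞. Then Y(t) = 0 for every t ≥ 0. -/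
open MeasureTheory Real Set Filter

/-- A bounded measurable function has interval integrable nonnegative powers. -/
lemma intervalIntegrable_rpow_of_bounded {f : ℝ → ℝ} (hf : Measurable f) {a b M θ : ℝ}
    (hab : a ≤ b) (hθ : 0 ≤ θ) (h0 : ∀ s ∈ Icc a b, 0 ≤ f s) (hM : ∀ s ∈ Icc a b, f s ≤ M) :
    IntervalIntegrable (fun s => f s ^ θ) volume a b := by
  rw [intervalIntegrable_iff_integrableOn_Icc_of_le hab]
  refine Measure.integrableOn_of_bounded (M := M ^ θ) (by simp)
    (hf.pow_const θ).aestronglyMeasurable ?_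
  filter_upwards [ae_restrict_mem measurableSet_Icc] with s hs
  rw [Real.norm_of_nonneg (rpow_nonneg (h0 s hs) _)]
  exact rpow_le_rpow (h0 s hs) (hM s hs) hθ

/-- Monotonicity of the interval integral when only the larger function is known
to be integrable. -/
lemma intervalIntegral_mono_of_nonneg {f g : ℝ → ℝ} {a b : ℝ} (hab : a ≤ b)
    (hg : IntervalIntegrable g volume a b) (h0 : ∀ s ∈ Icc a b, 0 ≤ f s)
    (hfg : ∀ s ∈ Icc a b, f s ≤ g s) : ∫ s in a..b, f s ≤ ∫ s in a..b, g s := by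
  rw [intervalIntegral.integral_of_le hab, intervalIntegral.integral_of_le hab]
  refine integral_mono_of_nonneg ?_ ((intervalIntegrable_iff_integrableOn_Ioc_of_le hab).1 hg) ?_
  · filter_upwards [ae_restrict_mem measurableSet_Ioc] with s hs using h0 s (Ioc_subset_Icc_self hs)
  · filter_upwards [ae_restrict_mem measurableSet_Ioc] with s hs using hfg s (Ioc_subset_Icc_self hs)

lemma pow_succ_rpow_div {x : ℝ} (hx : 0 ≤ x) (n : ℕ) :
    (x ^ (n + 1)) ^ ((n : ℝ) / (n + 1)) = x ^ n := by
  rw [← rpow_natCast x (n + 1), ← rpow_mul hx, ← rpow_natCast x n]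
  congr 1
  push_cast
  field_simp

lemma integral_shift_pow_le (a t η : ℝ) (hη : 0 ≤ η) (n : ℕ) :
    (n + 1 : ℝ) * ∫ s in a..t, (s - a + η) ^ n ≤ (t - a + η) ^ (n + 1) := by
  have h : ∫ s in a..t, (s - a + η) ^ n = ∫ s in a..t, (s - (a - η)) ^ n := by
    congr 1
    ext s
    ring
  rw [h, intervalIntegral.integral_comp_sub_right (fun s => s ^ n), integral_pow,
    mul_div_cancel₀ _ (by positivity : (n + 1 : ℝ) ≠ 0)]
  have h1 : t - (a - η) = t - a + η := by ring
  have h2 : a - (a - η) = η := by ring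
  rw [h1, h2]
  linarith [pow_nonneg hη (n + 1)]

/-- A bounded nonnegative subsolution of `y = K (n + 1) ∫ y ^ (n / (n + 1))` is dominated by
the explicit solutions `(K (t - a + η)) ^ (n + 1)`. -/
lemma le_pow_of_le_integral_rpow {f : ℝ → ℝ} {a b K M η : ℝ} (n : ℕ)
    (hK : 0 ≤ K) (hη : 0 < η)
    (h0 : ∀ s ∈ Icc a b, 0 ≤ f s) (hM : ∀ s ∈ Icc a b, f s ≤ M)
    (h : ∀ t ∈ Icc a b, f t ≤ K * (n + 1) * ∫ s in a..t, f s ^ ((n : ℝ) / (n + 1))) :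
    ∀ t ∈ Icc a b, f t ≤ (K * (t - a + η)) ^ (n + 1) := by
  intro t₀ ht₀
  have hu : ∀ s ∈ Icc a b, 0 < s - a + η := fun s hs => by linarith [hs.1]
  set q : ℝ → ℝ := fun s => f s / (s - a + η) ^ (n + 1) with hq
  have hM0 : 0 ≤ M := (h0 t₀ ht₀).trans (hM t₀ ht₀)
  have hbdd : BddAbove (q '' Icc a b) := by
    refine ⟨M / η ^ (n + 1), ?_⟩
    rintro _ ⟨s, hs, rfl⟩
    have : η ≤ s - a + η := by linarith [hs.1]
    exact div_le_div₀ hM0 (hM s hs) (by positivity) (by gcongr)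
  set S := sSup (q '' Icc a b) with hS
  have hqS : ∀ s ∈ Icc a b, q s ≤ S := fun s hs => le_csSup hbdd (mem_image_of_mem q hs)
  have hS0 : 0 ≤ S :=
    (div_nonneg (h0 t₀ ht₀) (pow_nonneg (hu t₀ ht₀).le _)).trans (hqS t₀ ht₀)
  obtain ⟨R, hR0, hRS⟩ : ∃ R : ℝ, 0 ≤ R ∧ R ^ (n + 1) = S :=
    ⟨S ^ (((n + 1 : ℕ) : ℝ)⁻¹), rpow_nonneg hS0 _, rpow_inv_natCast_pow hS0 (by simp)⟩
  have hfR : ∀ s ∈ Icc a b, f s ≤ (R * (s - a + η)) ^ (n + 1) := by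
    intro s hs
    rw [mul_pow, hRS]
    exact (div_le_iff₀ (pow_pos (hu s hs) _)).1 (hqS s hs)
  have hSle : S ≤ K * R ^ n := by
    refine csSup_le ⟨_, mem_image_of_mem q ht₀⟩ ?_
    rintro _ ⟨t, ht, rfl⟩
    rw [hq, div_le_iff₀ (pow_pos (hu t ht) _)]
    have hint : ∫ s in a..t, f s ^ ((n : ℝ) / (n + 1)) ≤ ∫ s in a..t, R ^ n * (s - a + η) ^ n := by
      refine intervalIntegral_mono_of_nonneg ht.1
        (Continuous.intervalIntegrable (by fun_prop) _ _) ?_ ?_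
      · exact fun s hs => rpow_nonneg (h0 s ⟨hs.1, hs.2.trans ht.2⟩) _
      · intro s hs
        have hs' : s ∈ Icc a b := ⟨hs.1, hs.2.trans ht.2⟩
        rw [← mul_pow, ← pow_succ_rpow_div (mul_nonneg hR0 (hu s hs').le) n]
        exact rpow_le_rpow (h0 s hs') (hfR s hs') (by positivity)
    rw [intervalIntegral.integral_const_mul] at hint
    calc f t ≤ K * (n + 1) * ∫ s in a..t, f s ^ ((n : ℝ) / (n + 1)) := h t ht
      _ ≤ K * (n + 1) * (R ^ n * ∫ s in a..t, (s - a + η) ^ n) := by gcongr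
      _ = K * R ^ n * ((n + 1) * ∫ s in a..t, (s - a + η) ^ n) := by ring
      _ ≤ K * R ^ n * (t - a + η) ^ (n + 1) := by
        gcongr
        exact integral_shift_pow_le a t η hη.le n
  have hRK : R ≤ K := by
    rcases hR0.eq_or_lt with hR | hR
    · exact hR ▸ hK
    · rw [← hRS, pow_succ'] at hSle
      exact le_of_mul_le_mul_right hSle (pow_pos hR n)
  refine (hfR t₀ ht₀).trans ?_
  have := (hu t₀ ht₀).le
  gcongr

/-- A nonnegative bounded function satisfying `f ≤ K (n + 1) ∫ f ^ (n / (n + 1))` for all large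
`n` vanishes. -/
lemma eq_zero_of_eventually_le_integral_rpow {f : ℝ → ℝ} {T K M : ℝ} (hf : Measurable f)
    (hK : 0 < K) (h0 : ∀ s ∈ Icc 0 T, 0 ≤ f s) (hM : ∀ s ∈ Icc 0 T, f s ≤ M)
    (h : ∀ᶠ n : ℕ in atTop, ∀ t ∈ Icc 0 T,
      f t ≤ K * (n + 1) * ∫ s in (0 : ℝ)..t, f s ^ ((n : ℝ) / (n + 1))) :
    ∀ t ∈ Icc 0 T, f t = 0 := by
  set δ := 1 / (4 * K) with hδ
  have hδ0 : 0 < δ := by positivity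
  have hKδ : K * (δ + δ) = 1 / 2 := by
    rw [hδ]
    field_simp
    norm_num
  have step : ∀ k : ℕ, ∀ t ∈ Icc 0 T, t ≤ k * δ → f t = 0 := by
    intro k
    induction k with
    | zero =>
      intro t ht htk
      have ht0 : t = 0 := le_antisymm (by simpa using htk) ht.1
      obtain ⟨n, hn⟩ := h.exists
      have := hn t ht
      rw [ht0, intervalIntegral.integral_same, mul_zero] at this
      rw [ht0]
      exact le_antisymm this (h0 0 (ht0 ▸ ht))
    | succ k ih =>
      intro t ht htk
      rcases le_total t (k * δ) with htk' | htk'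
      · exact ih t ht htk'
      set a := k * δ with ha
      have ha0 : 0 ≤ a := by positivity
      have hsub : Icc a t ⊆ Icc 0 T := Icc_subset_Icc ha0 ht.2
      refine le_antisymm ?_ (h0 t ht)
      have hlim : Tendsto (fun n : ℕ => (1 / 2 : ℝ) ^ (n + 1)) atTop (nhds 0) :=
        (tendsto_add_atTop_iff_nat 1).2
          (tendsto_pow_atTop_nhds_zero_of_lt_one (by norm_num) (by norm_num))
      refine ge_of_tendsto hlim ?_
      filter_upwards [h, eventually_gt_atTop 0] with n hn hn0
      have hθ : (0 : ℝ) < (n : ℝ) / (n + 1) := by positivity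
      refine (le_pow_of_le_integral_rpow (a := a) (b := t) n hK.le hδ0
        (fun s hs => h0 s (hsub hs)) (fun s hs => hM s (hsub hs)) ?_ t ⟨htk', le_rfl⟩).trans ?_
      · intro r hr
        have hr' := hsub hr
        have hi : ∀ x ∈ Icc 0 T, ∀ y ∈ Icc 0 T, x ≤ y →
            IntervalIntegrable (fun s => f s ^ ((n : ℝ) / (n + 1))) volume x y :=
          fun x hx y hy hxy => intervalIntegrable_rpow_of_bounded hf hxy hθ.le
            (fun s hs => h0 s ⟨hx.1.trans hs.1, hs.2.trans hy.2⟩)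
            (fun s hs => hM s ⟨hx.1.trans hs.1, hs.2.trans hy.2⟩)
        have haT : a ∈ Icc 0 T := hsub ⟨le_rfl, htk'⟩
        have hz : ∫ s in (0 : ℝ)..a, f s ^ ((n : ℝ) / (n + 1)) = 0 := by
          rw [intervalIntegral.integral_congr (g := fun _ => (0 : ℝ)),
            intervalIntegral.integral_zero]
          intro s hs
          rw [uIcc_of_le ha0] at hs
          simp only [ih s ⟨hs.1, hs.2.trans haT.2⟩ hs.2, zero_rpow hθ.ne']
        have := hn r hr'
        rwa [← intervalIntegral.integral_add_adjacent_intervals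
          (hi 0 ⟨le_rfl, ha0.trans haT.2⟩ a haT ha0) (hi a haT r hr' hr.1), hz, zero_add] at this
      · rw [← hKδ]
        have : t - a ≤ δ := by
          push_cast at htk
          linarith
        have : 0 ≤ t - a := by linarith
        gcongr
  intro t ht
  obtain ⟨k, hk⟩ := exists_nat_ge (t / δ)
  exact step k t ht ((div_le_iff₀ hδ0).1 hk)

lemma mul_logPlus_nonneg {r : ℝ} (hr : 0 ≤ r) : 0 ≤ r * logPlus (1 / r) :=
  mul_nonneg hr (log_nonneg (le_max_right _ _))

lemma mul_logPlus_le {r θ : ℝ} (hr : 0 ≤ r) (hθ : θ < 1) :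
    r * logPlus (1 / r) ≤ r ^ θ / (1 - θ) := by
  have hθ' : 0 < 1 - θ := sub_pos.2 hθ
  rcases hr.eq_or_lt with rfl | hr
  · rw [zero_mul]
    exact div_nonneg (rpow_nonneg le_rfl _) hθ'.le
  rcases le_total (1 / r) 1 with h | h
  · rw [logPlus, max_eq_right h, log_one, mul_zero]
    positivity
  · rw [logPlus, max_eq_left h]
    calc r * log (1 / r) ≤ r * ((1 / r) ^ (1 - θ) / (1 - θ)) := by
          gcongr
          exact log_le_rpow_div (by positivity) hθ'
      _ = r ^ θ / (1 - θ) := by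
          rw [one_div, inv_rpow hr.le, rpow_sub hr, rpow_one]
          have := (rpow_pos_of_pos hr θ).ne'
          field_simp

lemma le_mul_rpow {r M θ : ℝ} (hr : 0 ≤ r) (hrM : r ≤ M) (hM : 1 ≤ M) (hθ₀ : 0 ≤ θ)
    (hθ : θ < 1) : r ≤ M * r ^ θ := by
  rcases hr.eq_or_lt with rfl | hr
  · exact mul_nonneg (zero_le_one.trans hM) (rpow_nonneg le_rfl _)
  calc r = r ^ (1 - θ) * r ^ θ := by rw [← rpow_add hr]; simp
    _ ≤ M * r ^ θ := by
      gcongr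
      calc r ^ (1 - θ) ≤ M ^ (1 - θ) := rpow_le_rpow hr.le hrM (by linarith)
        _ ≤ M ^ (1 : ℝ) := rpow_le_rpow_of_exponent_le hM (by linarith)
        _ = M := rpow_one M

lemma tendsto_div_add_one_nhdsLT :
    Tendsto (fun n : ℕ => (n : ℝ) / (n + 1)) atTop (nhdsWithin (1 : ℝ) (Iio 1)) := by
  refine tendsto_nhdsWithin_iff.2 ⟨tendsto_natCast_div_add_atTop 1, Eventually.of_forall ?_⟩
  intro n
  rw [mem_Iio, div_lt_one (by positivity)]
  linarith

/-- Osgood/Gronwall-type uniqueness inequality (Lemma 3.2). -/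
theorem osgood_gronwall_uniqueness
    (Y c₁ c₂ : ℝ → ℝ) (ε : ℝ) (c₃ : ℝ → ℝ → ℝ)
    (hY : ∀ t, 0 ≤ t → 0 ≤ Y t) (hYmeas : Measurable Y)
    (hYloc : ∀ T, 0 ≤ T → ∃ C : ℝ, ∀ s ∈ Set.Icc 0 T, Y s ≤ C)
    (hc₁ : ∀ t, 0 ≤ t → 0 ≤ c₁ t) (hc₁mono : MonotoneOn c₁ (Set.Ici 0))
    (hc₂ : ∀ t, 0 ≤ t → 0 ≤ c₂ t) (hc₂mono : MonotoneOn c₂ (Set.Ici 0))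
    (hε₀ : 0 ≤ ε) (hε₁ : ε < 1)
    (hc₃ : ∀ θ ∈ Set.Ioo ε 1, ∀ t, 0 ≤ t → 0 ≤ c₃ t θ)
    (hc₃mono : ∀ θ ∈ Set.Ioo ε 1, MonotoneOn (fun t => c₃ t θ) (Set.Ici 0))
    (hineq : ∀ θ ∈ Set.Ioo ε 1, ∀ t, 0 ≤ t →
      Y t ≤ c₁ t * (∫ s in (0:ℝ)..t, Y s)
        + c₂ t * (∫ s in (0:ℝ)..t, Y s * logPlus (1 / Y s))
        + c₃ t θ * ∫ s in (0:ℝ)..t, (Y s) ^ θ)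
    (hlimsup : ∀ t, 0 < t →
      ∃ C : ℝ, ∀ᶠ θ in nhdsWithin (1:ℝ) (Set.Iio 1), (1 - θ) * c₃ t θ ≤ C) :
    ∀ t, 0 ≤ t → Y t = 0 := by
  intro t₀ ht₀
  set T := t₀ + 1 with hT
  have hT0 : 0 < T := by linarith
  obtain ⟨M', hM'⟩ := hYloc T hT0.le
  obtain ⟨C', hC'⟩ := hlimsup T hT0
  set M := max M' 1
  set C := max C' 0
  have hM1 : 1 ≤ M := le_max_right _ _
  have hC0 : 0 ≤ C := le_max_right _ _
  have hY0 : ∀ s ∈ Icc 0 T, 0 ≤ Y s := fun s hs => hY s hs.1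
  have hYM : ∀ s ∈ Icc 0 T, Y s ≤ M := fun s hs => (hM' s hs).trans (le_max_left _ _)
  have hA := hc₁ T hT0.le
  have hB := hc₂ T hT0.le
  have hK : 0 < c₁ T * M + c₂ T + C + 1 := by positivity
  refine eq_zero_of_eventually_le_integral_rpow hYmeas hK hY0 hYM ?_ t₀ ⟨ht₀, by linarith⟩
  have hεn : ∀ᶠ θ in nhdsWithin (1 : ℝ) (Iio 1), θ ∈ Ioo ε 1 := Ioo_mem_nhdsLT hε₁
  filter_upwards [tendsto_div_add_one_nhdsLT.eventually hC',
    tendsto_div_add_one_nhdsLT.eventually hεn] with n hCn hθ t ht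
  have hθn : 1 - (n : ℝ) / (n + 1) = 1 / (n + 1) := by
    field_simp
    ring
  rw [hθn] at hCn
  set θ := (n : ℝ) / (n + 1)
  have hθ0 : 0 ≤ θ := hε₀.trans hθ.1.le
  have hn : (0 : ℝ) < n + 1 := by positivity
  have hsub : Icc 0 t ⊆ Icc 0 T := Icc_subset_Icc_right ht.2
  have hI : IntervalIntegrable (fun s => Y s ^ θ) volume 0 t :=
    intervalIntegrable_rpow_of_bounded hYmeas ht.1 hθ0 (fun s hs => hY0 s (hsub hs))
      (fun s hs => hYM s (hsub hs))
  set I := ∫ s in (0 : ℝ)..t, Y s ^ θ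
  have hI0 : 0 ≤ I :=
    intervalIntegral.integral_nonneg ht.1 fun s hs => rpow_nonneg (hY0 s (hsub hs)) _
  have hI1 : ∫ s in (0 : ℝ)..t, Y s ≤ M * I := by
    rw [← intervalIntegral.integral_const_mul]
    exact intervalIntegral_mono_of_nonneg ht.1 (hI.const_mul M) (fun s hs => hY0 s (hsub hs))
      fun s hs => le_mul_rpow (hY0 s (hsub hs)) (hYM s (hsub hs)) hM1 hθ0 hθ.2
  have hI2 : ∫ s in (0 : ℝ)..t, Y s * logPlus (1 / Y s) ≤ (n + 1) * I := by
    rw [← intervalIntegral.integral_const_mul]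
    refine intervalIntegral_mono_of_nonneg ht.1 (hI.const_mul _)
      (fun s hs => mul_logPlus_nonneg (hY0 s (hsub hs))) fun s hs => ?_
    refine (mul_logPlus_le (hY0 s (hsub hs)) hθ.2).trans_eq ?_
    rw [hθn]
    field_simp
  have h1 : c₁ t * ∫ s in (0 : ℝ)..t, Y s ≤ c₁ T * (M * I) :=
    mul_le_mul (hc₁mono ht.1 hT0.le ht.2) hI1
      (intervalIntegral.integral_nonneg ht.1 fun s hs => hY0 s (hsub hs)) hA
  have h2 : c₂ t * ∫ s in (0 : ℝ)..t, Y s * logPlus (1 / Y s) ≤ c₂ T * ((n + 1) * I) :=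
    mul_le_mul (hc₂mono ht.1 hT0.le ht.2) hI2
      (intervalIntegral.integral_nonneg ht.1 fun s hs => mul_logPlus_nonneg (hY0 s (hsub hs))) hB
  have hc : c₃ t θ ≤ C * (n + 1) := by
    refine (hc₃mono θ hθ ht.1 hT0.le ht.2).trans ?_
    rw [one_div, inv_mul_le_iff₀ hn] at hCn
    refine hCn.trans ?_
    rw [mul_comm]
    gcongr
    exact le_max_left _ _
  have h3 : c₃ t θ * I ≤ C * (n + 1) * I := mul_le_mul_of_nonneg_right hc hI0
  have h4 : c₁ T * (M * I) ≤ c₁ T * (M * I) * (n + 1) :=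
    le_mul_of_one_le_right (by positivity) (by linarith [n.cast_nonneg (α := ℝ)])
  have h5 : 0 ≤ (n + 1) * I := by positivity
  calc Y t ≤ _ := hineq θ hθ t ht.1
    _ ≤ c₁ T * (M * I) * (n + 1) + c₂ T * ((n + 1) * I) + C * (n + 1) * I + (n + 1) * I := by
      linarith
    _ = (c₁ T * M + c₂ T + C + 1) * (n + 1) * I := by ring
end

section
/- For every t > 0, every x ∈ ℝ, and every η > 0, one has ∫_ℝ p_t(x,y)·e^{η|y|}·η|y| dy ≤ e^{η²t/2}·e^{η|x|}·η|x| + 2·e^{η²t/2}·( η²t + η·√(t/(2π)) )·e^{η|x|}. -/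
open MeasureTheory Real

/-- The one-dimensional heat kernel `p_t(x,y) = (2πt)^{-1/2} exp(-(x-y)²/(2t))`. -/
noncomputable def heatKernel (t x y : ℝ) : ℝ :=
  (Real.sqrt (2 * Real.pi * t))⁻¹ * Real.exp (-(x - y) ^ 2 / (2 * t))

lemma integrable_max_mul_exp_neg_sq {t : ℝ} (ht : 0 < t) :
    Integrable fun z : ℝ => max z 0 * Real.exp (-z ^ 2 / (2 * t)) := by
  have hb : 0 < (2 * t)⁻¹ := by positivity
  refine (integrable_mul_exp_neg_mul_sq hb).mono (by fun_prop) (Filter.Eventually.of_forall ?_)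
  intro z
  rw [norm_mul, norm_mul, show -z ^ 2 / (2 * t) = -(2 * t)⁻¹ * z ^ 2 by ring]
  gcongr
  rw [Real.norm_eq_abs, Real.norm_eq_abs, abs_of_nonneg (le_max_right z 0)]
  exact max_le (le_abs_self z) (abs_nonneg z)

lemma integral_max_mul_exp_neg_sq {t : ℝ} (ht : 0 < t) :
    ∫ z : ℝ, max z 0 * Real.exp (-z ^ 2 / (2 * t)) = t := by
  have hb : 0 < (2 * t)⁻¹ := by positivity
  have h : (fun z : ℝ => max z 0 * Real.exp (-z ^ 2 / (2 * t))) =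
      (Set.Ioi 0).indicator fun z : ℝ => z ^ (1 : ℝ) * Real.exp (-(2 * t)⁻¹ * z ^ (2 : ℝ)) := by
    ext z
    by_cases hz : 0 < z
    · rw [Set.indicator_of_mem (Set.mem_Ioi.mpr hz), max_eq_left hz.le, Real.rpow_one,
        Real.rpow_two]
      ring_nf
    · rw [Set.indicator_of_notMem (by simpa using hz), max_eq_right (not_lt.mp hz), zero_mul]
  rw [h, integral_indicator measurableSet_Ioi,
    integral_rpow_mul_exp_neg_mul_rpow (by norm_num) (by norm_num) hb]
  norm_num [Real.rpow_neg_one]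
  ring

lemma inv_sqrt_two_pi_mul_self {t : ℝ} (ht : 0 < t) :
    (Real.sqrt (2 * Real.pi * t))⁻¹ * t = Real.sqrt (t / (2 * Real.pi)) := by
  rw [Real.sqrt_mul (by positivity), Real.sqrt_div ht.le]
  have h := Real.mul_self_sqrt ht.le
  have : 0 < Real.sqrt t := Real.sqrt_pos.mpr ht
  have : 0 < Real.sqrt (2 * Real.pi) := Real.sqrt_pos.mpr (by positivity)
  field_simp
  nlinarith

lemma heatKernel_nonneg (t x y : ℝ) : 0 ≤ heatKernel t x y := by
  unfold heatKernel; positivity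

lemma heatKernel_eq_gaussianPDFReal {t : ℝ} (ht : 0 < t) (m : ℝ) :
    heatKernel t m = ProbabilityTheory.gaussianPDFReal m ⟨t, ht.le⟩ := by
  ext y
  simp only [heatKernel, ProbabilityTheory.gaussianPDFReal, sub_sq_comm m y]
  rfl

lemma integrable_heatKernel {t : ℝ} (ht : 0 < t) (m : ℝ) : Integrable (heatKernel t m) := by
  rw [heatKernel_eq_gaussianPDFReal ht]
  exact ProbabilityTheory.integrable_gaussianPDFReal _ _

lemma integral_heatKernel {t : ℝ} (ht : 0 < t) (m : ℝ) : ∫ y, heatKernel t m y = 1 := by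
  rw [heatKernel_eq_gaussianPDFReal ht]
  exact ProbabilityTheory.integral_gaussianPDFReal_eq_one _ fun h => ht.ne' (congrArg Subtype.val h)

lemma heatKernel_mul_max_sub (t m y : ℝ) :
    heatKernel t m y * max (m - y) 0 = (Real.sqrt (2 * Real.pi * t))⁻¹ *
      (max (m - y) 0 * Real.exp (-(m - y) ^ 2 / (2 * t))) := by
  unfold heatKernel; ring

lemma heatKernel_neg_neg (t m y : ℝ) : heatKernel t (-m) (-y) = heatKernel t m y := by
  unfold heatKernel; ring_nf

lemma integrable_heatKernel_mul_max_sub {t : ℝ} (ht : 0 < t) (m : ℝ) :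
    Integrable fun y => heatKernel t m y * max (m - y) 0 := by
  simp only [heatKernel_mul_max_sub]
  exact ((integrable_max_mul_exp_neg_sq ht).comp_sub_left m).const_mul _

lemma integral_heatKernel_mul_max_sub {t : ℝ} (ht : 0 < t) (m : ℝ) :
    ∫ y, heatKernel t m y * max (m - y) 0 = Real.sqrt (t / (2 * Real.pi)) := by
  simp only [heatKernel_mul_max_sub]
  rw [integral_const_mul,
    integral_sub_left_eq_self (fun z : ℝ => max z 0 * Real.exp (-z ^ 2 / (2 * t))) volume m,
    integral_max_mul_exp_neg_sq ht, inv_sqrt_two_pi_mul_self ht]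

lemma heatKernel_mul_exp {t : ℝ} (ht : 0 < t) (x y η : ℝ) :
    heatKernel t x y * Real.exp (-(η * y)) =
      Real.exp (η ^ 2 * t / 2) * Real.exp (-(η * x)) * heatKernel t (x - η * t) y := by
  unfold heatKernel
  have h : Real.exp (-(x - y) ^ 2 / (2 * t)) * Real.exp (-(η * y)) =
      Real.exp (η ^ 2 * t / 2) * Real.exp (-(η * x)) *
        Real.exp (-(x - η * t - y) ^ 2 / (2 * t)) := by
    rw [← Real.exp_add, ← Real.exp_add, ← Real.exp_add]
    congr 1
    field_simp
    ring
  linear_combination (Real.sqrt (2 * Real.pi * t))⁻¹ * h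

/-- The contribution of the negative half-line is bounded by an integrable function whose
integral is explicit. -/
lemma exists_majorant_heatKernel_mul_exp_neg {t η : ℝ} (ht : 0 < t) (hη : 0 < η) (x : ℝ) :
    ∃ g : ℝ → ℝ, Integrable g ∧
      (∀ y, heatKernel t x y * Real.exp (-(η * y)) * (η * max (-y) 0) ≤ g y) ∧
      ∫ y, g y = Real.exp (η ^ 2 * t / 2) * Real.exp (-(η * x)) *
        (η * max (-x) 0 + η ^ 2 * t + η * Real.sqrt (t / (2 * Real.pi))) := by
  set m := x - η * t with hm
  set C := Real.exp (η ^ 2 * t / 2) * Real.exp (-(η * x)) with hC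
  have h1 := (integrable_heatKernel ht m).mul_const (max (-x) 0 + η * t)
  have h2 := integrable_heatKernel_mul_max_sub ht m
  refine ⟨fun y => C * η * (heatKernel t m y * (max (-x) 0 + η * t) +
    heatKernel t m y * max (m - y) 0), (h1.add h2).const_mul _, fun y => ?_, ?_⟩
  · have hy : max (-y) 0 ≤ max (-x) 0 + η * t + max (m - y) 0 := by
      have : 0 < η * t := by positivity
      refine max_le ?_ (by positivity)
      have := le_max_left (-x) 0
      have := le_max_left (m - y) 0
      linarith
    have hc : 0 ≤ C * η * heatKernel t m y :=
      mul_nonneg (by positivity) (heatKernel_nonneg t m y)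
    rw [heatKernel_mul_exp ht]
    linarith [mul_le_mul_of_nonneg_left hy hc]
  · rw [integral_const_mul, integral_add h1 h2, integral_mul_const, integral_heatKernel ht,
      integral_heatKernel_mul_max_sub ht]
    ring

/-- Estimate (3.14) of the paper. -/
theorem heatKernel_exp_mul_integral_bound (t x η : ℝ) (ht : 0 < t) (hη : 0 < η) :
    (∫ y : ℝ, heatKernel t x y * Real.exp (η * |y|) * (η * |y|)) ≤
      Real.exp (η ^ 2 * t / 2) * Real.exp (η * |x|) * (η * |x|)
        + 2 * Real.exp (η ^ 2 * t / 2) * (η ^ 2 * t + η * Real.sqrt (t / (2 * Real.pi)))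
            * Real.exp (η * |x|) := by
  obtain ⟨g, hg, hgle, hgint⟩ := exists_majorant_heatKernel_mul_exp_neg ht hη x
  obtain ⟨f, hf, hfle, hfint⟩ := exists_majorant_heatKernel_mul_exp_neg ht hη (-x)
  have hfneg : Integrable fun y => f (-y) := hf.comp_neg
  calc ∫ y : ℝ, heatKernel t x y * Real.exp (η * |y|) * (η * |y|)
      ≤ ∫ y, (f (-y) + g y) := by
        refine integral_mono_of_nonneg (Filter.Eventually.of_forall fun y => ?_) (hfneg.add hg)
          (Filter.Eventually.of_forall fun y => ?_)
        · have := heatKernel_nonneg t x y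
          simp only [Pi.zero_apply]
          positivity
        · have h1 := hfle (-y)
          have h2 := hgle y
          simp only [heatKernel_neg_neg, neg_neg, mul_neg] at h1
          rcases le_total 0 y with hy | hy
          · simp only [abs_of_nonneg hy, max_eq_left hy,
              max_eq_right (neg_nonpos.mpr hy)] at h1 h2 ⊢
            linarith
          · simp only [abs_of_nonpos hy, max_eq_right hy,
              max_eq_left (neg_nonneg.mpr hy), mul_neg] at h1 h2 ⊢
            linarith
    _ = Real.exp (η ^ 2 * t / 2) * Real.exp (η * x) *
          (η * max x 0 + η ^ 2 * t + η * Real.sqrt (t / (2 * Real.pi))) +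
        Real.exp (η ^ 2 * t / 2) * Real.exp (-(η * x)) *
          (η * max (-x) 0 + η ^ 2 * t + η * Real.sqrt (t / (2 * Real.pi))) := by
        rw [integral_add hfneg hg, integral_neg_eq_self f, hfint, hgint]
        simp only [mul_neg, neg_neg]
    _ ≤ _ := by
        have hpos : Real.exp (η * x) ≤ Real.exp (η * |x|) := by
          gcongr; exact le_abs_self x
        have hneg : Real.exp (-(η * x)) ≤ Real.exp (η * |x|) := by
          rw [← mul_neg]; gcongr; exact neg_le_abs x
        have hmax : Real.exp (η * x) * max x 0 + Real.exp (-(η * x)) * max (-x) 0 =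
            Real.exp (η * |x|) * |x| := by
          rcases le_total 0 x with hx | hx
          · simp [abs_of_nonneg hx, hx]
          · simp [abs_of_nonpos hx, hx]
        have hc : 0 ≤ Real.exp (η ^ 2 * t / 2) *
            (η ^ 2 * t + η * Real.sqrt (t / (2 * Real.pi))) := by positivity
        linear_combination Real.exp (η ^ 2 * t / 2) * η * hmax +
          mul_le_mul_of_nonneg_left (add_le_add hpos hneg) hc
end

section
/- For all x, y ∈ ℝ and all η, t > 0, one has ∫_ℝ |p_t(x,z) − p_t(y,z)|·e^{η|z|} dz ≤ 2√2 · ( |x−y| / √t ) · e^{η²t} · e^{η(|x| + |x−y|)}. -/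
open MeasureTheory Real

lemma hasDerivAt_heatKernel_segment {t : ℝ} (ht : 0 < t) (x y z s : ℝ) :
    HasDerivAt (fun s : ℝ => heatKernel t (x + s * (y - x)) z)
      ((√(2 * π * t))⁻¹ * (exp (-(x + s * (y - x) - z) ^ 2 / (2 * t)) *
        (-(x + s * (y - x) - z) * (y - x) / t))) s := by
  have h1 : HasDerivAt (fun s : ℝ => x + s * (y - x) - z) (y - x) s := by
    simpa using (((hasDerivAt_id s).mul_const (y - x)).const_add x).sub_const z
  have h2 := (((h1.pow 2).neg.div_const (2 * t)).exp).const_mul (√(2 * π * t))⁻¹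
  refine h2.congr_deriv ?_
  simp only [Pi.neg_apply, Pi.pow_apply]
  field_simp
  push_cast
  ring

lemma abs_mul_exp_neg_sq_div_le {t : ℝ} (ht : 0 < t) (w : ℝ) :
    exp (-w ^ 2 / (2 * t)) * (|w| / t) ≤ (√t)⁻¹ * exp (-w ^ 2 / (4 * t)) := by
  have hs : 0 < √t := sqrt_pos.2 ht
  have hst : √t ^ 2 = t := sq_sqrt ht.le
  have hr : |w| / √t ≤ exp (w ^ 2 / (4 * t)) := by
    have h1 := add_one_le_exp (w ^ 2 / (4 * t))
    have h2 : w ^ 2 / (4 * t) = (|w| / √t) ^ 2 / 4 := by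
      rw [div_pow, sq_abs, hst]; field_simp
    nlinarith [sq_nonneg (|w| / √t - 2)]
  have h3 : exp (-w ^ 2 / (2 * t)) * exp (w ^ 2 / (4 * t)) = exp (-w ^ 2 / (4 * t)) := by
    rw [← exp_add]; congr 1; field_simp; ring
  calc exp (-w ^ 2 / (2 * t)) * (|w| / t)
      = (√t)⁻¹ * (exp (-w ^ 2 / (2 * t)) * (|w| / √t)) := by
        nth_rewrite 2 [← hst]; field_simp
    _ ≤ (√t)⁻¹ * (exp (-w ^ 2 / (2 * t)) * exp (w ^ 2 / (4 * t))) := by gcongr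
    _ = _ := by rw [h3]

lemma abs_heatKernel_sub_le {t : ℝ} (ht : 0 < t) (x y z : ℝ) :
    |heatKernel t x z - heatKernel t y z| ≤ ∫ s in (0 : ℝ)..1,
      (√(2 * π * t))⁻¹ * (|x - y| / √t) * exp (-(x + s * (y - x) - z) ^ 2 / (4 * t)) := by
  have hftc := intervalIntegral.integral_eq_sub_of_hasDerivAt (a := 0) (b := 1)
    (fun s _ => hasDerivAt_heatKernel_segment ht x y z s)
    (Continuous.intervalIntegrable (by fun_prop) _ _)
  simp only [one_mul, zero_mul, add_zero, add_sub_cancel] at hftc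
  rw [abs_sub_comm, ← hftc, ← norm_eq_abs]
  refine intervalIntegral.norm_integral_le_of_norm_le zero_le_one
    (Filter.Eventually.of_forall fun s _ => ?_)
    (Continuous.intervalIntegrable (by fun_prop) _ _)
  have h := abs_mul_exp_neg_sq_div_le ht (x + s * (y - x) - z)
  rw [norm_eq_abs, abs_mul, abs_mul, abs_div, abs_mul, abs_neg, abs_exp, abs_of_pos ht,
    abs_of_nonneg (by positivity : 0 ≤ (√(2 * π * t))⁻¹), abs_sub_comm y x]
  calc _ = (√(2 * π * t))⁻¹ * |x - y| *
        (exp (-(x + s * (y - x) - z) ^ 2 / (2 * t)) * (|x + s * (y - x) - z| / t)) := by ring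
    _ ≤ (√(2 * π * t))⁻¹ * |x - y| *
        ((√t)⁻¹ * exp (-(x + s * (y - x) - z) ^ 2 / (4 * t))) := by gcongr
    _ = _ := by ring

lemma lintegral_exp_neg_sub_sq_div {t : ℝ} (ht : 0 < t) (c : ℝ) :
    ∫⁻ z : ℝ, ENNReal.ofReal (exp (-(z - c) ^ 2 / (4 * t))) =
      ENNReal.ofReal (√(4 * π * t)) := by
  have hb : 0 < (4 * t)⁻¹ := by positivity
  have h := lintegral_sub_right_eq_self (μ := volume)
    (fun w : ℝ => ENNReal.ofReal (exp (-(4 * t)⁻¹ * w ^ 2))) c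
  rw [← ofReal_integral_eq_lintegral_ofReal (integrable_exp_neg_mul_sq hb)
    (Filter.Eventually.of_forall fun _ => (exp_pos _).le), integral_gaussian] at h
  convert h using 4
  · congr 1; field_simp
  · field_simp

lemma exp_neg_sq_div_mul_exp_abs_le {η t : ℝ} (hη : 0 < η) (ht : 0 < t) (u z : ℝ) :
    exp (-(u - z) ^ 2 / (4 * t)) * exp (η * |z|) ≤
      exp (η * |u|) * exp (η ^ 2 * t) * (exp (-(z - (u + 2 * η * t)) ^ 2 / (4 * t)) +
        exp (-(z - (u - 2 * η * t)) ^ 2 / (4 * t))) := by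
  rw [mul_add, ← exp_add, ← exp_add, ← exp_add, ← exp_add]
  have hz : |z| ≤ |u| + |z - u| := by simpa using abs_add_le u (z - u)
  have hηz := mul_le_mul_of_nonneg_left hz hη.le
  have e1 : η * |u| + η ^ 2 * t + -(z - (u + 2 * η * t)) ^ 2 / (4 * t) =
      -(u - z) ^ 2 / (4 * t) + η * (|u| + (z - u)) := by field_simp; ring
  have e2 : η * |u| + η ^ 2 * t + -(z - (u - 2 * η * t)) ^ 2 / (4 * t) =
      -(u - z) ^ 2 / (4 * t) + η * (|u| + -(z - u)) := by field_simp; ring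
  rw [e1, e2]
  rcases abs_choice (z - u) with h | h
  · rw [h] at hηz
    exact (exp_le_exp.2 (by linarith)).trans (le_add_of_nonneg_right (exp_pos _).le)
  · rw [h] at hηz
    exact (exp_le_exp.2 (by linarith)).trans (le_add_of_nonneg_left (exp_pos _).le)

lemma lintegral_exp_neg_sq_div_mul_exp_abs_le {η t : ℝ} (hη : 0 < η) (ht : 0 < t) (u : ℝ) :
    ∫⁻ z : ℝ, ENNReal.ofReal (exp (-(u - z) ^ 2 / (4 * t)) * exp (η * |z|)) ≤
      ENNReal.ofReal (exp (η * |u|) * exp (η ^ 2 * t) * (2 * √(4 * π * t))) := by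
  calc _ ≤ ∫⁻ z : ℝ, ENNReal.ofReal (exp (η * |u|) * exp (η ^ 2 * t)) *
        (ENNReal.ofReal (exp (-(z - (u + 2 * η * t)) ^ 2 / (4 * t))) +
          ENNReal.ofReal (exp (-(z - (u - 2 * η * t)) ^ 2 / (4 * t)))) := by
        refine lintegral_mono fun z => ?_
        rw [← ENNReal.ofReal_add (by positivity) (by positivity),
          ← ENNReal.ofReal_mul (by positivity)]
        exact ENNReal.ofReal_le_ofReal (exp_neg_sq_div_mul_exp_abs_le hη ht u z)
    _ = _ := by
        rw [lintegral_const_mul _ (by fun_prop), lintegral_add_left (by fun_prop),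
          lintegral_exp_neg_sub_sq_div ht, lintegral_exp_neg_sub_sq_div ht,
          ← ENNReal.ofReal_add (by positivity) (by positivity),
          ← ENNReal.ofReal_mul (by positivity), two_mul]

/-- Weighted spatial-increment bound for the heat kernel (Lemma 3.4 (iii)). -/
theorem heatKernel_space_increment_weighted (x y η t : ℝ) (hη : 0 < η) (ht : 0 < t) :
    (∫ z : ℝ, |heatKernel t x z - heatKernel t y z| * Real.exp (η * |z|)) ≤
      2 * Real.sqrt 2 * (|x - y| / Real.sqrt t) * Real.exp (η ^ 2 * t)
        * Real.exp (η * (|x| + |x - y|)) := by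
  set K : ℝ := (√(2 * π * t))⁻¹ * (|x - y| / √t) with hK
  have hK0 : 0 ≤ K := by positivity
  have hconst : K * (exp (η * (|x| + |x - y|)) * exp (η ^ 2 * t) * (2 * √(4 * π * t))) =
      2 * √2 * (|x - y| / √t) * exp (η ^ 2 * t) * exp (η * (|x| + |x - y|)) := by
    have h : √(4 * π * t) = √2 * √(2 * π * t) := by
      rw [← sqrt_mul zero_le_two]; congr 1; ring
    have h0 : √(2 * π * t) ≠ 0 := (sqrt_pos.2 (by positivity)).ne'
    rw [hK, h]
    field_simp
  rw [integral_eq_lintegral_of_nonneg_ae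
    (Filter.Eventually.of_forall fun z => by positivity)
    (by unfold heatKernel; exact Continuous.aestronglyMeasurable (by fun_prop))]
  refine ENNReal.toReal_le_of_le_ofReal (by positivity) ?_
  calc ∫⁻ z : ℝ, ENNReal.ofReal (|heatKernel t x z - heatKernel t y z| * exp (η * |z|))
      ≤ ∫⁻ z : ℝ, ∫⁻ s in Set.Ioc (0 : ℝ) 1, ENNReal.ofReal
          (K * (exp (-(x + s * (y - x) - z) ^ 2 / (4 * t)) * exp (η * |z|))) := by
        refine lintegral_mono fun z => ?_
        rw [← ofReal_integral_eq_lintegral_ofReal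
          (Continuous.integrableOn_Ioc (by fun_prop))
          (Filter.Eventually.of_forall fun s => by positivity),
          ← intervalIntegral.integral_of_le zero_le_one]
        refine ENNReal.ofReal_le_ofReal ?_
        simp_rw [← mul_assoc]
        rw [intervalIntegral.integral_mul_const]
        exact mul_le_mul_of_nonneg_right (abs_heatKernel_sub_le ht x y z) (exp_pos _).le
    _ = ∫⁻ s in Set.Ioc (0 : ℝ) 1, ∫⁻ z : ℝ, ENNReal.ofReal
          (K * (exp (-(x + s * (y - x) - z) ^ 2 / (4 * t)) * exp (η * |z|))) :=
        lintegral_lintegral_swap (Measurable.aemeasurable (by fun_prop))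
    _ ≤ ∫⁻ _ in Set.Ioc (0 : ℝ) 1, ENNReal.ofReal
          (K * (exp (η * (|x| + |x - y|)) * exp (η ^ 2 * t) * (2 * √(4 * π * t)))) := by
        refine setLIntegral_mono measurable_const fun s hs => ?_
        have hu : |x + s * (y - x)| ≤ |x| + |x - y| := by
          refine (abs_add_le _ _).trans ?_
          rw [abs_mul, abs_of_pos hs.1, abs_sub_comm y x]
          gcongr
          exact mul_le_of_le_one_left (abs_nonneg _) hs.2
        simp_rw [ENNReal.ofReal_mul hK0]
        rw [lintegral_const_mul _ (by fun_prop)]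
        gcongr
        refine (lintegral_exp_neg_sq_div_mul_exp_abs_le hη ht _).trans ?_
        gcongr
    _ = _ := by rw [hconst]; simp
end

section
/- For all x, y ∈ ℝ and all times 0 < s ≤ t, one has ∫₀^s ∫_ℝ |p_{t−r}(x,z) − p_{s−r}(y,z)|² dz dr ≤ ((√2 − 1)/√π)·|t−s|^{1/2} + (2/√π)·|x−y|. -/
open MeasureTheory Real

lemma heatKernel_mul_heatKernel {a b : ℝ} (ha : 0 < a) (hb : 0 < b) (x y z : ℝ) :
    heatKernel a x z * heatKernel b y z =
      ((√(2 * π * a))⁻¹ * (√(2 * π * b))⁻¹ * exp (-(x - y) ^ 2 / (2 * (a + b)))) *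
        exp (-((a + b) / (2 * a * b)) * (z - (b * x + a * y) / (a + b)) ^ 2) := by
  have key : exp (-(x - z) ^ 2 / (2 * a)) * exp (-(y - z) ^ 2 / (2 * b)) =
      exp (-(x - y) ^ 2 / (2 * (a + b))) *
        exp (-((a + b) / (2 * a * b)) * (z - (b * x + a * y) / (a + b)) ^ 2) := by
    rw [← exp_add, ← exp_add]
    congr 1
    field_simp
    ring
  unfold heatKernel
  linear_combination (√(2 * π * a))⁻¹ * (√(2 * π * b))⁻¹ * key

lemma integrable_heatKernel_mul_heatKernel {a b : ℝ} (ha : 0 < a) (hb : 0 < b) (x y : ℝ) :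
    Integrable fun z => heatKernel a x z * heatKernel b y z := by
  simp_rw [heatKernel_mul_heatKernel ha hb]
  have hk : 0 < (a + b) / (2 * a * b) := by positivity
  exact ((integrable_exp_neg_mul_sq hk).comp_sub_right _).const_mul _

/-- The semigroup (Chapman–Kolmogorov) property of the heat kernel. -/
lemma integral_heatKernel_mul_heatKernel {a b : ℝ} (ha : 0 < a) (hb : 0 < b) (x y : ℝ) :
    ∫ z, heatKernel a x z * heatKernel b y z = heatKernel (a + b) x y := by
  simp_rw [heatKernel_mul_heatKernel ha hb]
  rw [integral_const_mul,
    integral_sub_right_eq_self (fun z => exp (-((a + b) / (2 * a * b)) * z ^ 2)),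
    integral_gaussian]
  have key : (√(2 * π * a))⁻¹ * (√(2 * π * b))⁻¹ * √(π / ((a + b) / (2 * a * b))) =
      (√(2 * π * (a + b)))⁻¹ := by
    rw [← sqrt_inv, ← sqrt_inv, ← sqrt_inv, ← sqrt_mul (by positivity),
      ← sqrt_mul (by positivity)]
    congr 1
    field_simp
  unfold heatKernel
  linear_combination exp (-(x - y) ^ 2 / (2 * (a + b))) * key

lemma heatKernel_self (t x : ℝ) : heatKernel t x x = (√(2 * π * t))⁻¹ := by
  simp [heatKernel]

lemma integral_sq_heatKernel_sub {a b : ℝ} (ha : 0 < a) (hb : 0 < b) (x y : ℝ) :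
    ∫ z, |heatKernel a x z - heatKernel b y z| ^ 2 =
      (√(2 * π * (a + a)))⁻¹ + (√(2 * π * (b + b)))⁻¹ - 2 * heatKernel (a + b) x y := by
  have expand : ∀ z, |heatKernel a x z - heatKernel b y z| ^ 2 =
      heatKernel a x z * heatKernel a x z + heatKernel b y z * heatKernel b y z -
        2 * (heatKernel a x z * heatKernel b y z) := by
    intro z
    rw [sq_abs]
    ring
  have iaa := integrable_heatKernel_mul_heatKernel ha ha x x
  have ibb := integrable_heatKernel_mul_heatKernel hb hb y y
  have iab := integrable_heatKernel_mul_heatKernel ha hb x y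
  simp_rw [expand]
  rw [integral_sub (iaa.fun_add ibb) (iab.const_mul 2), integral_add iaa ibb, integral_const_mul,
    integral_heatKernel_mul_heatKernel ha ha, integral_heatKernel_mul_heatKernel hb hb,
    integral_heatKernel_mul_heatKernel ha hb, heatKernel_self, heatKernel_self]

/-- A primitive on `[0, ∞)` of `u ↦ min 1 (c / u) / √u`. -/
noncomputable def minPrimitive (c u : ℝ) : ℝ :=
  2 * √(min u c) + (2 * √c - 2 * (c / √(max u c)))

lemma continuous_minPrimitive {c : ℝ} (hc : 0 ≤ c) : Continuous (minPrimitive c) := by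
  unfold minPrimitive
  rcases hc.eq_or_lt with rfl | hc
  · simp only [zero_div]
    fun_prop
  · have : ∀ u, √(max u c) ≠ 0 := fun u => (sqrt_pos.2 (lt_max_of_lt_right hc)).ne'
    fun_prop (disch := exact this _)

lemma div_sqrt_max_le (c u : ℝ) : c / √(max u c) ≤ √c := by
  rcases le_or_gt c 0 with hc | hc
  · exact (div_nonpos_of_nonpos_of_nonneg hc (sqrt_nonneg _)).trans (sqrt_nonneg _)
  · rw [div_le_iff₀ (sqrt_pos.2 (lt_max_of_lt_right hc))]
    calc c = √c * √c := (mul_self_sqrt hc.le).symm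
      _ ≤ √c * √(max u c) := by gcongr; exact le_max_right _ _

lemma minPrimitive_nonneg (c u : ℝ) : 0 ≤ minPrimitive c u := by
  have := div_sqrt_max_le c u
  have := sqrt_nonneg (min u c)
  unfold minPrimitive
  linarith

lemma minPrimitive_le {c : ℝ} (hc : 0 ≤ c) (u : ℝ) : minPrimitive c u ≤ 4 * √c := by
  have : √(min u c) ≤ √c := sqrt_le_sqrt (min_le_right _ _)
  have : 0 ≤ c / √(max u c) := by positivity
  unfold minPrimitive
  linarith

lemma hasDerivWithinAt_minPrimitive {c u : ℝ} (hu : 0 < u) :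
    HasDerivWithinAt (minPrimitive c) (min 1 (c / u) / √u) (Set.Iic u) u := by
  have hsu : √u ≠ 0 := (sqrt_pos.2 hu).ne'
  rcases le_or_gt u c with huc | huc
  · have hmin : min 1 (c / u) = 1 := min_eq_left ((one_le_div hu).2 huc)
    have hd : HasDerivAt (fun v => 2 * √v + (2 * √c - 2 * (c / √c))) (min 1 (c / u) / √u) u := by
      refine (((hasDerivAt_sqrt hu.ne').const_mul 2).add_const _).congr_deriv ?_
      rw [hmin]
      field_simp
    refine hd.hasDerivWithinAt.congr_of_mem (fun v hv => ?_) Set.self_mem_Iic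
    have hvc : v ≤ c := le_trans hv huc
    rw [minPrimitive, min_eq_left hvc, max_eq_right hvc]
  · have hmin : min 1 (c / u) = c / u := min_eq_right ((div_le_one hu).2 huc.le)
    have hd : HasDerivAt (fun v => 2 * √c + (2 * √c - 2 * (c / √v))) (min 1 (c / u) / √u) u := by
      refine ((((hasDerivAt_const u c).div (hasDerivAt_sqrt hu.ne') hsu).const_mul
        2).const_sub _ |>.const_add _).congr_deriv ?_
      rw [hmin, sq_sqrt hu.le]
      field_simp
      ring
    refine (hd.congr_of_eventuallyEq ?_).hasDerivWithinAt
    filter_upwards [lt_mem_nhds huc] with v hv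
    rw [minPrimitive, min_eq_right hv.le, max_eq_left hv.le]

lemma sub_heatKernel_le {u : ℝ} (hu : 0 < u) (x y : ℝ) :
    (√(2 * π * u))⁻¹ - heatKernel u x y ≤
      (√(2 * π))⁻¹ * (min 1 ((x - y) ^ 2 / 2 / u) / √u) := by
  have h1 : 1 - exp (-(x - y) ^ 2 / (2 * u)) ≤ min 1 ((x - y) ^ 2 / 2 / u) := by
    refine le_min (by linarith [exp_pos (-(x - y) ^ 2 / (2 * u))]) ?_
    have h := add_one_le_exp (-(x - y) ^ 2 / (2 * u))
    have e : -(x - y) ^ 2 / (2 * u) = -((x - y) ^ 2 / 2 / u) := by field_simp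
    linarith
  have h2 : (√(2 * π * u))⁻¹ = (√(2 * π))⁻¹ * (√u)⁻¹ := by
    rw [sqrt_mul (by positivity), mul_inv]
  calc (√(2 * π * u))⁻¹ - heatKernel u x y
      = (√(2 * π))⁻¹ * ((1 - exp (-(x - y) ^ 2 / (2 * u))) / √u) := by
        rw [heatKernel, h2]
        ring
    _ ≤ _ := by gcongr

lemma sqrt_add_sqrt_le (s t : ℝ) (hs : 0 ≤ s) (ht : 0 ≤ t) :
    √t + √s ≤ √2 * √(t + s) := by
  rw [← sqrt_mul zero_le_two]
  apply le_sqrt_of_sq_le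
  nlinarith [sq_nonneg (√t - √s), sq_sqrt hs, sq_sqrt ht]

/-- L² space-time modulus-of-continuity estimate for the heat kernel
(Lemma 3.4 (v)). -/
theorem heatKernel_L2_spacetime_modulus (x y s t : ℝ) (hs : 0 < s) (hst : s ≤ t) :
    (∫ r in (0:ℝ)..s, ∫ z : ℝ,
        |heatKernel (t - r) x z - heatKernel (s - r) y z| ^ 2) ≤
      ((Real.sqrt 2 - 1) / Real.sqrt Real.pi) * |t - s| ^ ((1:ℝ)/2)
        + (2 / Real.sqrt Real.pi) * |x - y| := by
  set f : ℝ → ℝ := fun r => ∫ z : ℝ, |heatKernel (t - r) x z - heatKernel (s - r) y z| ^ 2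
  have hpi : 0 < √π := sqrt_pos.2 pi_pos
  have h2 : 0 < √2 := by positivity
  have h22 : √2 * √2 = 2 := mul_self_sqrt zero_le_two
  by_cases hf : IntervalIntegrable f volume 0 s
  swap
  · rw [intervalIntegral.integral_undef hf]
    have : 0 ≤ √2 - 1 := sub_nonneg.2 (one_le_sqrt.2 one_le_two)
    positivity
  set c : ℝ := (x - y) ^ 2 / 2 with hc_def
  have hc : 0 ≤ c := by positivity
  set g : ℝ → ℝ := fun r => (√π)⁻¹ * (√2 * √(t + s - 2 * r) - √(t - r) - √(s - r)) -
    (√(2 * π))⁻¹ * minPrimitive c (t + s - 2 * r)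
  set g' : ℝ → ℝ := fun r => (√(2 * π * ((t - r) + (t - r))))⁻¹ +
    (√(2 * π * ((s - r) + (s - r))))⁻¹ - 2 * (√(2 * π * ((t - r) + (s - r))))⁻¹ +
    2 * ((√(2 * π))⁻¹ * (min 1 (c / ((t - r) + (s - r))) / √((t - r) + (s - r))))
  have hg : Continuous g := by
    have := continuous_minPrimitive hc
    fun_prop
  have hderiv : ∀ r ∈ Set.Ioo 0 s, HasDerivWithinAt g (g' r) (Set.Ioi r) r := by
    intro r hr
    have hb : 0 < s - r := sub_pos.2 hr.2
    have ha : 0 < t - r := by linarith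
    have hu : 0 < t + s - 2 * r := by linarith
    have hlin : HasDerivAt (fun r : ℝ => t + s - 2 * r) (-2) r := by
      simpa using ((hasDerivAt_id r).const_mul 2).const_sub (t + s)
    have d1 := (hlin.sqrt hu.ne').const_mul √2
    have d2 := ((hasDerivAt_id r).const_sub t).sqrt ha.ne'
    have d3 := ((hasDerivAt_id r).const_sub s).sqrt hb.ne'
    have d4 := (hasDerivWithinAt_minPrimitive (c := c) hu).comp r
      (hlin.hasDerivWithinAt (s := Set.Ioi r))
      (fun v (hv : r < v) => by simp only [Set.mem_Iic]; linarith)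
    refine ((((d1.sub d2).sub d3).const_mul (√π)⁻¹).hasDerivWithinAt.sub
      (d4.const_mul (√(2 * π))⁻¹)).congr_deriv ?_
    have e : (t - r) + (s - r) = t + s - 2 * r := by ring
    have q : ∀ v : ℝ, 0 < v → (√(2 * π * (v + v)))⁻¹ = (√π)⁻¹ * (1 / (2 * √v)) := by
      intro v hv
      have : 2 * π * (v + v) = 2 ^ 2 * (π * v) := by ring
      rw [this, sqrt_mul (by positivity), sqrt_sq zero_le_two, sqrt_mul pi_pos.le]
      field_simp
    have hsu := sqrt_pos.2 hu
    have q' : (√(2 * π * (t + s - 2 * r)))⁻¹ = (√π)⁻¹ * (√2 / 2 / √(t + s - 2 * r)) := by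
      rw [sqrt_mul (by positivity), sqrt_mul zero_le_two]
      field_simp
      nlinarith
    simp only [g', e, id]
    rw [q _ ha, q _ hb, q']
    ring
  have hle : ∀ r ∈ Set.Ioo 0 s, f r ≤ g' r := by
    intro r hr
    have hb : 0 < s - r := sub_pos.2 hr.2
    have ha : 0 < t - r := by linarith
    have := sub_heatKernel_le (add_pos ha hb) x y
    simp only [f, g']
    rw [integral_sq_heatKernel_sub ha hb]
    linarith
  have hint := intervalIntegral.integral_le_sub_of_hasDeriv_right_of_le hs.le hg.continuousOn
    hderiv ((intervalIntegrable_iff_integrableOn_Icc_of_le hs.le).1 hf) hle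
  refine hint.trans ?_
  have hG : (√(2 * π))⁻¹ * (minPrimitive c (t + s) - minPrimitive c (t - s)) ≤
      2 / √π * |x - y| := by
    have hsc : √c = |x - y| / √2 := by rw [hc_def, sqrt_div (sq_nonneg _), sqrt_sq_eq_abs]
    calc (√(2 * π))⁻¹ * (minPrimitive c (t + s) - minPrimitive c (t - s))
        ≤ (√(2 * π))⁻¹ * (4 * √c) := by
          gcongr
          linarith [minPrimitive_le hc (t + s), minPrimitive_nonneg c (t - s)]
      _ = 2 / √π * |x - y| := by
          rw [hsc, sqrt_mul zero_le_two]
          field_simp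
          linear_combination (-2 * |x - y|) * h22
  have hS := mul_le_mul_of_nonneg_left (sqrt_add_sqrt_le s t hs.le (hs.le.trans hst))
    (inv_nonneg.2 hpi.le)
  have e : t + s - 2 * s = t - s := by ring
  rw [abs_of_nonneg (sub_nonneg.2 hst), ← sqrt_eq_rpow]
  simp only [g, e, sub_self, sqrt_zero, mul_zero, sub_zero]
  rw [div_eq_mul_inv (√2 - 1)]
  linarith
end

section
/- For every t > 0 and all x, y, z ∈ ℝ, one has |p_t(x,z) − p_t(y,z)| ≤ √(2/t)·|x−y| · ∫₀¹ (4πt)^{−1/2}·exp( −(x + ρ(y−x) − z)² / (4t) ) dρ. -/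
open MeasureTheory Real

/-- The spatial derivative of the heat kernel in its first argument. -/
theorem hasDerivAt_heatKernel (t u z : ℝ) (ht : 0 < t) :
    HasDerivAt (fun u => heatKernel t u z) (-((u - z) / t) * heatKernel t u z) u := by
  have h : HasDerivAt (fun u : ℝ => -(u - z) ^ 2 / (2 * t)) (-((u - z) / t)) u := by
    refine (((((hasDerivAt_id' u).sub_const z).fun_pow 2).fun_neg).div_const (2 * t)).congr_deriv ?_
    field_simp
    norm_num [mul_comm]
  refine (h.exp.const_mul (√(2 * π * t))⁻¹).congr_deriv ?_
  rw [heatKernel]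
  ring

/-- The derivative of the heat kernel at time `t` is dominated by the heat kernel at time `2t`. -/
theorem abs_deriv_heatKernel_le (t u z : ℝ) (ht : 0 < t) :
    |-((u - z) / t) * heatKernel t u z| ≤
      √(2 / t) * ((√(4 * π * t))⁻¹ * exp (-(u - z) ^ 2 / (4 * t))) := by
  have hs : 0 < √t := sqrt_pos.2 ht
  have hst : √t ^ 2 = t := sq_sqrt ht.le
  have hc : √(2 / t) * (√(4 * π * t))⁻¹ = (√t)⁻¹ * (√(2 * π * t))⁻¹ := by
    rw [← sqrt_inv, ← sqrt_inv, ← sqrt_inv, ← sqrt_mul (by positivity),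
      ← sqrt_mul (by positivity)]
    congr 1
    field_simp
    norm_num
  have he : exp (-(u - z) ^ 2 / (2 * t)) =
      exp (-(u - z) ^ 2 / (4 * t)) * exp (-(u - z) ^ 2 / (4 * t)) := by
    rw [← exp_add]
    congr 1
    field_simp
    ring
  have hb : |u - z| / t * exp (-(u - z) ^ 2 / (4 * t)) ≤ (√t)⁻¹ := by
    have h₁ : |u - z| / √t ≤ exp ((u - z) ^ 2 / (4 * t)) := by
      refine le_trans ?_ (add_one_le_exp _)
      have h₂ : (u - z) ^ 2 / (4 * t) = (|u - z| / √t) ^ 2 / 4 := by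
        rw [div_pow, sq_abs, hst]
        field_simp
      rw [h₂]
      nlinarith [sq_nonneg (|u - z| / √t - 2)]
    rw [neg_div, exp_neg, ← div_eq_mul_inv, div_le_iff₀ (exp_pos _)]
    calc |u - z| / t = (√t)⁻¹ * (|u - z| / √t) := by
          rw [← hst, sqrt_sq hs.le]
          field_simp
      _ ≤ _ := by gcongr
  rw [← mul_assoc, hc, heatKernel, abs_mul, abs_neg, abs_div, abs_of_pos ht,
    abs_of_nonneg (by positivity : 0 ≤ (√(2 * π * t))⁻¹ * exp (-(u - z) ^ 2 / (2 * t))), he]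
  calc _ = |u - z| / t * exp (-(u - z) ^ 2 / (4 * t)) *
        ((√(2 * π * t))⁻¹ * exp (-(u - z) ^ 2 / (4 * t))) := by ring
    _ ≤ (√t)⁻¹ * ((√(2 * π * t))⁻¹ * exp (-(u - z) ^ 2 / (4 * t))) := by gcongr
    _ = _ := by ring

/-- Pointwise gradient-type bound on spatial increments of the heat kernel
(proof of Lemma 3.4). -/
theorem heatKernel_space_increment_pointwise (t x y z : ℝ) (ht : 0 < t) :
    |heatKernel t x z - heatKernel t y z| ≤
      Real.sqrt (2 / t) * |x - y| *
        ∫ ρ in (0:ℝ)..1,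
          (Real.sqrt (4 * Real.pi * t))⁻¹
            * Real.exp (-(x + ρ * (y - x) - z) ^ 2 / (4 * t)) := by
  have hd (ρ : ℝ) : HasDerivAt (fun ρ => heatKernel t (x + ρ * (y - x)) z)
      (-((x + ρ * (y - x) - z) / t) * heatKernel t (x + ρ * (y - x)) z * (y - x)) ρ := by
    have h : HasDerivAt (fun ρ : ℝ => x + ρ * (y - x)) (y - x) ρ := by
      simpa using ((hasDerivAt_id ρ).mul_const (y - x)).const_add x
    exact HasDerivAt.comp (h₂ := fun u => heatKernel t u z) ρ
      (hasDerivAt_heatKernel t (x + ρ * (y - x)) z ht) h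
  have hi := intervalIntegral.integral_eq_sub_of_hasDerivAt (a := 0) (b := 1)
    (fun ρ _ => hd ρ) (Continuous.intervalIntegrable (by unfold heatKernel; fun_prop) _ _)
  simp only [one_mul, zero_mul, add_zero, add_sub_cancel] at hi
  rw [abs_sub_comm, ← hi, ← intervalIntegral.integral_const_mul, ← norm_eq_abs]
  refine intervalIntegral.norm_integral_le_of_norm_le zero_le_one
    (Filter.Eventually.of_forall fun ρ _ => ?_)
    (Continuous.intervalIntegrable (by fun_prop) _ _)
  rw [norm_eq_abs, abs_mul, abs_sub_comm y x, mul_right_comm]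
  gcongr
  exact abs_deriv_heatKernel_le t _ z ht
end
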